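/- Equivalence of the minimax DR layer and its dual minimization: under the hypotheses that φ : [0, ∞) → ℝ is convex with φ(1) = 0 and δ > 0 (so the uniform distribution q is a Slater point of the ambiguity set P(δ)), and that R(ε_jᵀz − c) is finite for all j, z ∈ Z, c ∈ ℝ, one has, for every γ ∈ ℝ and ŷ ∈ ℝⁿ, min_{z ∈ Z, c ∈ ℝ} max_{p ∈ P(δ)} Σ_{j=1}^T p_j R(ε_jᵀz − c) − γ·ŷᵀz = inf_{z ∈ Z, λ ≥ 0, ξ ∈ ℝ, c ∈ ℝ} [ ξ + δλ + (λ/T) Σ_{j=1}^T φ*((R(ε_jᵀz − c) − ξ)/λ) ] − γ·ŷᵀz, where Z = {z ∈ ℝⁿ : z ≥ 0, 1ᵀz = 1}. -/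

import Mathlib

open Filter Topology

/-- A convex function on `[0, ∞)` vanishing at `1` has a subgradient at `1`. -/
lemma exists_subgradient_at_one {φ : ℝ → ℝ} (hφ : ConvexOn ℝ (Set.Ici 0) φ) (hφ1 : φ 1 = 0) :
    ∃ k : ℝ, ∀ s, 0 ≤ s → k * (s - 1) ≤ φ s := by
  have h1 : (1 : ℝ) ∈ interior (Set.Ici (0 : ℝ)) := by simp
  refine ⟨derivWithin φ (Set.Ioi 1) 1, fun s hs => ?_⟩
  rcases lt_trichotomy s 1 with h | rfl | h
  · have h2 := (hφ.slope_le_leftDeriv_of_mem_interior hs h1 h).trans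
      (hφ.leftDeriv_le_rightDeriv_of_mem_interior h1)
    rw [slope_def_field, hφ1, div_le_iff₀ (by linarith)] at h2
    linarith
  · simp [hφ1]
  · have h2 := hφ.rightDeriv_le_slope_of_mem_interior h1 hs h
    rw [slope_def_field, hφ1, le_div_iff₀ (by linarith)] at h2
    linarith

/-- A bound on a separable sum over a product set splits into bounds on the summands. -/
lemma exists_separate_bounds {ι α : Type*} [Fintype ι] {S : Set α} (hS : S.Nonempty)
    (g : ι → α → ℝ) (B : ℝ) (h : ∀ s : ι → α, (∀ j, s j ∈ S) → ∑ j, g j (s j) ≤ B) :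
    ∃ M : ι → ℝ, (∀ j, ∀ x ∈ S, g j x ≤ M j) ∧ ∑ j, M j ≤ B := by
  classical
  obtain ⟨x₀, hx₀⟩ := hS
  have hbdd : ∀ j, BddAbove (g j '' S) := by
    intro j
    refine ⟨B - ∑ i ∈ Finset.univ.erase j, g i x₀, ?_⟩
    rintro _ ⟨x, hx, rfl⟩
    have h1 := h (Function.update (fun _ => x₀) j x) (fun i => by
      by_cases hi : i = j
      · subst hi; simpa using hx
      · simpa [hi] using hx₀)
    rw [← Finset.add_sum_erase _ _ (Finset.mem_univ j)] at h1
    have h2 : ∑ i ∈ Finset.univ.erase j, g i (Function.update (fun _ => x₀) j x i)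
        = ∑ i ∈ Finset.univ.erase j, g i x₀ :=
      Finset.sum_congr rfl fun i hi => by
        rw [Function.update_of_ne (Finset.ne_of_mem_erase hi)]
    rw [h2, Function.update_self] at h1
    linarith
  refine ⟨fun j => sSup (g j '' S), fun j x hx => le_csSup (hbdd j) ⟨x, hx, rfl⟩, ?_⟩
  refine le_of_forall_pos_le_add fun η hη => ?_
  have hc : (0 : ℝ) < Fintype.card ι + 1 := by positivity
  have hclose : ∀ j, ∃ x ∈ S, sSup (g j '' S) - η / (Fintype.card ι + 1) < g j x := by
    intro j
    obtain ⟨_, ⟨x, hx, rfl⟩, hlt⟩ := exists_lt_of_lt_csSup (Set.Nonempty.image (g j) ⟨x₀, hx₀⟩)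
      (sub_lt_self (sSup (g j '' S)) (div_pos hη hc))
    exact ⟨x, hx, hlt⟩
  choose s hsS hs using hclose
  have h1 : ∑ j, (sSup (g j '' S) - η / (Fintype.card ι + 1)) ≤ ∑ j, g j (s j) :=
    Finset.sum_le_sum fun j _ => (hs j).le
  rw [Finset.sum_sub_distrib, Finset.sum_const, Finset.card_univ, nsmul_eq_mul] at h1
  have h2 : (Fintype.card ι : ℝ) * (η / (Fintype.card ι + 1)) ≤ η := by
    rw [mul_div_assoc', div_le_iff₀ hc]
    nlinarith
  linarith [h s hsS]

/-- Existence of Lagrange multipliers for the maximization of the mean of `s j * a j` over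
densities `s` with mean `1` and mean `φ`-value at most `δ`. -/
lemma exists_lagrange_multipliers {T : ℕ} (hT : 0 < T) {φ : ℝ → ℝ}
    (hφ : ConvexOn ℝ (Set.Ici 0) φ) (hφ1 : φ 1 = 0) {δ : ℝ} (hδ : 0 < δ)
    {a : Fin T → ℝ} (ha : ∀ j, 0 ≤ a j) {V : ℝ}
    (hV : ∀ s : Fin T → ℝ, (∀ j, 0 ≤ s j) → (T : ℝ)⁻¹ * ∑ j, s j = 1 →
      (T : ℝ)⁻¹ * ∑ j, φ (s j) ≤ δ → (T : ℝ)⁻¹ * ∑ j, s j * a j ≤ V) :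
    ∃ l ξ : ℝ, 0 ≤ l ∧ ∀ s : Fin T → ℝ, (∀ j, 0 ≤ s j) →
      ξ + δ * l + (T : ℝ)⁻¹ * ∑ j, (s j * (a j - ξ) - l * φ (s j)) ≤ V := by
  have hT' : (0 : ℝ) < T := by exact_mod_cast hT
  have hN : (0 : ℝ) < (T : ℝ)⁻¹ := by positivity
  have hconst : ∀ x : ℝ, (T : ℝ)⁻¹ * ∑ _j : Fin T, x = x := fun x => by
    simp [Finset.sum_const]; field_simp
  set C : Set (ℝ × ℝ × ℝ) := {x | ∃ s : Fin T → ℝ, (∀ j, 0 ≤ s j) ∧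
    (T : ℝ)⁻¹ * ∑ j, s j - 1 = x.1 ∧ (T : ℝ)⁻¹ * ∑ j, φ (s j) - δ ≤ x.2.1 ∧
    x.2.2 ≤ (T : ℝ)⁻¹ * ∑ j, s j * a j}
  have hCconv : Convex ℝ C := by
    rintro ⟨α, β, t⟩ ⟨s, hs, h1, h2, h3⟩ ⟨α', β', t'⟩ ⟨s', hs', h1', h2', h3'⟩ u v hu hv huv
    refine ⟨fun j => u * s j + v * s' j,
      fun j => add_nonneg (mul_nonneg hu (hs j)) (mul_nonneg hv (hs' j)), ?_, ?_, ?_⟩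
    · simp only [Prod.smul_fst, Prod.fst_add, smul_eq_mul] at *
      rw [Finset.sum_add_distrib, ← Finset.mul_sum, ← Finset.mul_sum, ← h1, ← h1']
      linear_combination huv
    · simp only [Prod.smul_fst, Prod.fst_add, Prod.smul_snd, Prod.snd_add, smul_eq_mul] at *
      have h4 : ∑ j, φ (u * s j + v * s' j) ≤ u * ∑ j, φ (s j) + v * ∑ j, φ (s' j) := by
        rw [Finset.mul_sum, Finset.mul_sum, ← Finset.sum_add_distrib]
        exact Finset.sum_le_sum fun j _ => hφ.2 (hs j) (hs' j) hu hv huv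
      have h5 := mul_le_mul_of_nonneg_left h4 hN.le
      have h6 := mul_le_mul_of_nonneg_left h2 hu
      have h7 := mul_le_mul_of_nonneg_left h2' hv
      have h8 : δ = u * δ + v * δ := by rw [← add_mul, huv, one_mul]
      linarith
    · simp only [Prod.smul_snd, Prod.snd_add, smul_eq_mul] at *
      have h4 : ∑ j, (u * s j + v * s' j) * a j
          = u * ∑ j, s j * a j + v * ∑ j, s' j * a j := by
        rw [Finset.mul_sum, Finset.mul_sum, ← Finset.sum_add_distrib]
        exact Finset.sum_congr rfl fun j _ => by ring
      rw [h4]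
      have h6 := mul_le_mul_of_nonneg_left h3 hu
      have h7 := mul_le_mul_of_nonneg_left h3' hv
      linarith
  have hbox : Set.Ioo (-1 / 2 : ℝ) (1 / 2) ×ˢ
      (Set.Ioi (max (φ (1 / 2)) (φ (3 / 2)) - δ) ×ˢ Set.Iio (0 : ℝ)) ⊆ C := by
    rintro ⟨α, β, t⟩ ⟨⟨h1, h1'⟩, h2, h3⟩
    simp only [Set.mem_Ioi, Set.mem_Iio] at h1 h1' h2 h3
    refine ⟨fun _ => 1 + α, fun _ => by linarith, by rw [hconst]; ring, ?_, ?_⟩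
    · rw [hconst]
      have := hφ.le_max_of_mem_Icc (x := 1 / 2) (y := 3 / 2) (z := 1 + α)
        (by norm_num) (by norm_num) ⟨by linarith, by linarith⟩
      simp only
      linarith
    · exact h3.le.trans (mul_nonneg hN.le (Finset.sum_nonneg fun j _ =>
        mul_nonneg (by linarith) (ha j)))
  have hint : (interior C).Nonempty :=
    ⟨(0, max (φ (1 / 2)) (φ (3 / 2)) - δ + 1, -1),
      interior_maximal hbox (isOpen_Ioo.prod (isOpen_Ioi.prod isOpen_Iio))
        ⟨by norm_num, by simp, by simp⟩⟩
  have hpt : ((0, 0, V) : ℝ × ℝ × ℝ) ∉ interior C := by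
    intro hmem
    have hcont : Tendsto (fun e : ℝ => ((0, 0, V + e) : ℝ × ℝ × ℝ)) (𝓝[>] 0) (𝓝 (0, 0, V)) := by
      have : Continuous (fun e : ℝ => ((0, 0, V + e) : ℝ × ℝ × ℝ)) := by fun_prop
      simpa using (this.tendsto 0).mono_left nhdsWithin_le_nhds
    obtain ⟨e, ⟨s, hs, h1, h2, h3⟩, he⟩ :=
      ((hcont.eventually (mem_interior_iff_mem_nhds.1 hmem)).and self_mem_nhdsWithin).exists
    simp only at h1 h2 h3 he
    linarith [hV s hs (by linarith) (by linarith)]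
  obtain ⟨f, hf⟩ := geometric_hahn_banach_open_point hCconv.interior isOpen_interior hpt
  have hfC : ∀ x ∈ C, f x ≤ f (0, 0, V) := by
    intro x hx
    have hx' : x ∈ closure (interior C) := by
      rw [hCconv.closure_interior_eq_closure_of_nonempty_interior hint]
      exact subset_closure hx
    exact closure_minimal (fun y hy => (hf y hy).le)
      (isClosed_le f.continuous continuous_const) hx'
  obtain ⟨κ, m, μ, hfeq⟩ : ∃ κ m μ : ℝ, ∀ α β t : ℝ, f (α, β, t) = κ * α + m * β + μ * t := by
    refine ⟨f (1, 0, 0), f (0, 1, 0), f (0, 0, 1), fun α β t => ?_⟩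
    have : ((α, β, t) : ℝ × ℝ × ℝ)
        = α • (1, 0, 0) + β • (0, 1, 0) + t • (0, 0, 1) := by simp
    rw [this, map_add, map_add, map_smul, map_smul, map_smul]
    simp only [smul_eq_mul]
    ring
  have hconstC : ∀ x β t : ℝ, 0 ≤ x → φ x - δ ≤ β → t ≤ 0 →
      κ * (x - 1) + m * β + μ * t ≤ μ * V := by
    intro x β t hx hβ ht
    have := hfC (x - 1, β, t) ⟨fun _ => x, fun _ => hx, by rw [hconst],
      by rw [hconst]; exact hβ,
      ht.trans (mul_nonneg hN.le (Finset.sum_nonneg fun j _ => mul_nonneg hx (ha j)))⟩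
    rw [hfeq, hfeq] at this
    linarith
  have hm : m ≤ 0 := by
    by_contra hm
    push Not at hm
    have := hconstC 1 (max 0 ((μ * V + 1) / m)) 0 zero_le_one
      (by rw [hφ1]; linarith [le_max_left 0 ((μ * V + 1) / m)]) le_rfl
    have h2 : m * ((μ * V + 1) / m) ≤ m * max 0 ((μ * V + 1) / m) :=
      mul_le_mul_of_nonneg_left (le_max_right _ _) hm.le
    rw [mul_div_cancel₀ _ hm.ne'] at h2
    linarith
  have hμ : 0 ≤ μ := by
    by_contra hμ
    push Not at hμ
    have := hconstC 1 0 (min 0 ((μ * V + 1) / μ)) zero_le_one (by rw [hφ1]; linarith)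
      (min_le_left _ _)
    have h2 : μ * ((μ * V + 1) / μ) ≤ μ * min 0 ((μ * V + 1) / μ) :=
      mul_le_mul_of_nonpos_left (min_le_right _ _) hμ.le
    rw [mul_div_cancel₀ _ hμ.ne] at h2
    linarith
  have hμpos : 0 < μ := by
    refine lt_of_le_of_ne hμ fun h0 => ?_
    subst h0
    have h1 := hconstC 1 (-δ) 0 zero_le_one (by rw [hφ1]; linarith) le_rfl
    have hm0 : m = 0 := by nlinarith
    subst hm0
    have h2 := hconstC 0 (φ 0 - δ) 0 le_rfl le_rfl le_rfl
    have h3 := hconstC 2 (φ 2 - δ) 0 zero_le_two le_rfl le_rfl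
    have hκ : κ = 0 := by linarith
    subst hκ
    obtain ⟨⟨α, β, t⟩, hx⟩ := hint
    have := hf _ hx
    rw [hfeq, hfeq] at this
    linarith
  refine ⟨-m / μ, -κ / μ, div_nonneg (by linarith) hμ, fun s hs => ?_⟩
  have h1 := hfC (_, _, _) ⟨s, hs, rfl, le_rfl, le_rfl⟩
  rw [hfeq, hfeq] at h1
  have h2 : ∑ j, (s j * (a j - -κ / μ) - -m / μ * φ (s j))
      = ∑ j, s j * a j + κ / μ * ∑ j, s j + m / μ * ∑ j, φ (s j) := by
    rw [Finset.mul_sum, Finset.mul_sum, ← Finset.sum_add_distrib, ← Finset.sum_add_distrib]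
    exact Finset.sum_congr rfl fun j _ => by ring
  rw [h2, ← mul_le_mul_iff_right₀ hμpos]
  refine le_trans (le_of_eq ?_) (h1.trans (by linarith))
  field_simp
  ring

/-- Lagrange multipliers with a positive multiplier of the divergence constraint, at the price
of an arbitrarily small error. -/
lemma exists_approx_lagrange_multipliers {T : ℕ} (hT : 0 < T) {φ : ℝ → ℝ}
    (hφ : ConvexOn ℝ (Set.Ici 0) φ) (hφ1 : φ 1 = 0) {δ : ℝ} (hδ : 0 < δ)
    {a : Fin T → ℝ} (ha : ∀ j, 0 ≤ a j) {V : ℝ}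
    (hV : ∀ s : Fin T → ℝ, (∀ j, 0 ≤ s j) → (T : ℝ)⁻¹ * ∑ j, s j = 1 →
      (T : ℝ)⁻¹ * ∑ j, φ (s j) ≤ δ → (T : ℝ)⁻¹ * ∑ j, s j * a j ≤ V)
    {η : ℝ} (hη : 0 < η) :
    ∃ l ξ : ℝ, 0 < l ∧ ∀ s : Fin T → ℝ, (∀ j, 0 ≤ s j) →
      ξ + δ * l + (T : ℝ)⁻¹ * ∑ j, (s j * (a j - ξ) - l * φ (s j)) ≤ V + δ * η := by
  have hT' : (0 : ℝ) < T := by exact_mod_cast hT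
  obtain ⟨k, hk⟩ := exists_subgradient_at_one hφ hφ1
  obtain ⟨l, ξ, hl, h⟩ := exists_lagrange_multipliers hT hφ hφ1 hδ ha hV
  refine ⟨l + η, ξ - η * k, by linarith, fun s hs => ?_⟩
  have h1 : ∑ j, (s j * (a j - (ξ - η * k)) - (l + η) * φ (s j))
      ≤ ∑ j, ((s j * (a j - ξ) - l * φ (s j)) + η * k) :=
    Finset.sum_le_sum fun j _ => by
      have := mul_le_mul_of_nonneg_left (hk (s j) (hs j)) hη.le
      linarith
  rw [Finset.sum_add_distrib, Finset.sum_const, Finset.card_univ, Fintype.card_fin,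
    nsmul_eq_mul] at h1
  have h2 := mul_le_mul_of_nonneg_left h1 (inv_pos.2 hT').le
  rw [mul_add, inv_mul_cancel_left₀ hT'.ne'] at h2
  linarith [h s hs]

lemma EReal.coe_finset_sum {ι : Type*} (s : Finset ι) (g : ι → ℝ) :
    ((∑ j ∈ s, g j : ℝ) : EReal) = ∑ j ∈ s, (g j : EReal) :=
  map_sum (⟨⟨Real.toEReal, EReal.coe_zero⟩, EReal.coe_add⟩ : ℝ →+ EReal) g s

/-- Young's inequality for the scaled conjugate. -/
lemma young_le_mul_conjugate {φ : ℝ → ℝ} {φstar : ℝ → EReal}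
    (hφstar : ∀ w, φstar w = ⨆ s ∈ Set.Ici (0 : ℝ), ((s * w - φ s : ℝ) : EReal))
    {l : ℝ} (hl : 0 < l) (w : ℝ) {s : ℝ} (hs : 0 ≤ s) :
    ((s * w - l * φ s : ℝ) : EReal) ≤ (l : EReal) * φstar (w / l) := by
  have h1 : ((s * (w / l) - φ s : ℝ) : EReal) ≤ φstar (w / l) := by
    rw [hφstar]
    exact le_iSup₂ (f := fun s (_ : s ∈ Set.Ici (0 : ℝ)) =>
      ((s * (w / l) - φ s : ℝ) : EReal)) s hs
  have h2 : s * w - l * φ s = l * (s * (w / l) - φ s) := by field_simp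
  rw [h2, EReal.coe_mul]
  exact mul_le_mul_of_nonneg_left h1 (EReal.coe_nonneg.2 hl.le)

lemma mul_conjugate_le {φ : ℝ → ℝ} {φstar : ℝ → EReal}
    (hφstar : ∀ w, φstar w = ⨆ s ∈ Set.Ici (0 : ℝ), ((s * w - φ s : ℝ) : EReal))
    {l : ℝ} (hl : 0 < l) {w M : ℝ} (h : ∀ s, 0 ≤ s → s * w - l * φ s ≤ M) :
    (l : EReal) * φstar (w / l) ≤ (M : EReal) := by
  have h1 : φstar (w / l) ≤ ((M / l : ℝ) : EReal) := by
    rw [hφstar]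
    refine iSup₂_le fun s hs => EReal.coe_le_coe_iff.2 ?_
    rw [le_div_iff₀ hl]
    refine le_trans (le_of_eq ?_) (h s hs)
    field_simp
  refine (mul_le_mul_of_nonneg_left h1 (EReal.coe_nonneg.2 hl.le)).trans ?_
  rw [← EReal.coe_mul, mul_div_cancel₀ _ (ne_of_gt hl)]

/-- Young's inequality for the recession limit of the scaled conjugate. -/
lemma young_le_liminf_mul_conjugate {φ : ℝ → ℝ} {φstar : ℝ → EReal}
    (hφstar : ∀ w, φstar w = ⨆ s ∈ Set.Ici (0 : ℝ), ((s * w - φ s : ℝ) : EReal))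
    (w : ℝ) {s : ℝ} (hs : 0 ≤ s) :
    ((s * w : ℝ) : EReal) ≤ liminf (fun l : ℝ => (l : EReal) * φstar (w / l)) (𝓝[>] 0) := by
  have hlim : Tendsto (fun l : ℝ => ((s * w - l * φ s : ℝ) : EReal)) (𝓝[>] 0)
      (𝓝 ((s * w : ℝ) : EReal)) := by
    have : Continuous (fun l : ℝ => ((s * w - l * φ s : ℝ) : EReal)) :=
      continuous_coe_real_ereal.comp (by fun_prop)
    have h0 := (this.tendsto 0).mono_left (nhdsWithin_le_nhds (s := Set.Ioi 0))
    rwa [zero_mul, sub_zero] at h0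
  rw [← hlim.liminf_eq]
  refine liminf_le_liminf ?_
  filter_upwards [self_mem_nhdsWithin] with l hl
  exact young_le_mul_conjugate hφstar hl w hs

/-- Equivalence of the minimax DR layer and its dual minimization.
With `φ` convex, `φ(1) = 0`, `δ > 0` (so the uniform distribution is a Slater point of
the ambiguity set `P(δ)`), and `R` finite, for every `γ` and `ŷ`:
`min_{z ∈ Z, c} max_{p ∈ P(δ)} Σ_j p_j R(ε_jᵀz − c) − γ ŷᵀz
 = inf_{z ∈ Z, λ ≥ 0, ξ, c} [ξ + δλ + (λ/T) Σ_j φ*((R(ε_jᵀz − c) − ξ)/λ)] − γ ŷᵀz`,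
where at `λ = 0` the term `λ φ*(·/λ)` is the recession limit of the perspective. -/
theorem minimax_eq_dual_minimization {T n : ℕ} (hT : 0 < T)
    (ε : Fin T → Fin n → ℝ) (R : ℝ → ℝ)
    (hRconv : ConvexOn ℝ Set.univ R) (hRclosed : LowerSemicontinuous R)
    (hRnonneg : ∀ x, 0 ≤ R x) (hR0 : R 0 = 0) (hRsymm : ∀ x, R x = R (-x))
    (φ : ℝ → ℝ) (hφconv : ConvexOn ℝ (Set.Ici 0) φ) (hφ1 : φ 1 = 0)
    (δ : ℝ) (hδ : 0 < δ) (γ : ℝ) (yhat : Fin n → ℝ)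
    (φstar : ℝ → EReal)
    (hφstar : ∀ w, φstar w = ⨆ s ∈ Set.Ici (0 : ℝ), ((s * w - φ s : ℝ) : EReal))
    (persp : ℝ → ℝ → EReal)
    (hperspPos : ∀ l w, 0 < l → persp l w = (l : EReal) * φstar (w / l))
    (hperspZero : ∀ w, persp 0 w =
      Filter.liminf (fun l : ℝ => (l : EReal) * φstar (w / l)) (nhdsWithin 0 (Set.Ioi 0)))
    (Z : Set (Fin n → ℝ)) (hZ : Z = {z : Fin n → ℝ | (∀ i, 0 ≤ z i) ∧ ∑ i, z i = 1})
    (P : Set (Fin T → ℝ))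
    (hP : P = {p : Fin T → ℝ | (∀ j, 0 ≤ p j) ∧ (∑ j, p j = 1) ∧
      ∑ j, (1 / (T : ℝ)) * φ (p j / (1 / (T : ℝ))) ≤ δ}) :
    (⨅ z ∈ Z, ⨅ c : ℝ,
        (((⨆ p ∈ P, ∑ j, p j * R ((∑ i, ε j i * z i) - c))
            - γ * ∑ i, yhat i * z i : ℝ) : EReal))
      = ⨅ z ∈ Z, ⨅ l ∈ Set.Ici (0 : ℝ), ⨅ ξ : ℝ, ⨅ c : ℝ,
          ((ξ + δ * l - γ * ∑ i, yhat i * z i : ℝ) : EReal)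
            + (((T : ℝ)⁻¹ : ℝ) : EReal) *
                ∑ j, persp l (R ((∑ i, ε j i * z i) - c) - ξ) := by
  have hT' : (0 : ℝ) < T := by exact_mod_cast hT
  have hyoung : ∀ l w s : ℝ, 0 ≤ l → 0 ≤ s → ((s * w - l * φ s : ℝ) : EReal) ≤ persp l w := by
    intro l w s hl hs
    rcases hl.eq_or_lt with rfl | hl
    · rw [hperspZero, zero_mul, sub_zero]
      exact young_le_liminf_mul_conjugate hφstar w hs
    · rw [hperspPos l w hl]
      exact young_le_mul_conjugate hφstar hl w hs
  have huniform : (fun _ => (T : ℝ)⁻¹) ∈ P := by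
    rw [hP]
    refine ⟨fun _ => by positivity, ?_, ?_⟩
    · simp [hT'.ne']
    · simp [hT'.ne', hφ1, hδ.le]
  have hPnonneg : ∀ p ∈ P, ∀ j, 0 ≤ p j := fun p hp => by rw [hP] at hp; exact hp.1
  have hPsum : ∀ p ∈ P, ∑ j, p j = 1 := fun p hp => by rw [hP] at hp; exact hp.2.1
  have hPdiv : ∀ p ∈ P, (T : ℝ)⁻¹ * ∑ j, φ (T * p j) ≤ δ := fun p hp => by
    rw [hP] at hp
    refine le_trans (le_of_eq ?_) hp.2.2
    rw [Finset.mul_sum]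
    exact Finset.sum_congr rfl fun j _ => by rw [one_div, div_inv_eq_mul, mul_comm (p j)]
  apply le_antisymm
  · refine le_iInf₂ fun z hz => le_iInf₂ fun l hl => le_iInf fun ξ => le_iInf fun c => ?_
    refine (iInf₂_le z hz).trans ((iInf_le _ c).trans ?_)
    set a : Fin T → ℝ := fun j => R ((∑ i, ε j i * z i) - c)
    set y : ℝ := γ * ∑ i, yhat i * z i
    change (((⨆ p ∈ P, ∑ j, p j * a j) - y : ℝ) : EReal) ≤ ((ξ + δ * l - y : ℝ) : EReal)
      + (((T : ℝ)⁻¹ : ℝ) : EReal) * ∑ j, persp l (a j - ξ)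
    set E : EReal := ((ξ + δ * l - y : ℝ) : EReal)
      + (((T : ℝ)⁻¹ : ℝ) : EReal) * ∑ j, persp l (a j - ξ)
    have hweak : ∀ p ∈ P, ((∑ j, p j * a j - y : ℝ) : EReal) ≤ E := by
      intro p hp
      have h1 : ((∑ j, (T * p j * (a j - ξ) - l * φ (T * p j)) : ℝ) : EReal)
          ≤ ∑ j, persp l (a j - ξ) := by
        rw [EReal.coe_finset_sum]
        exact Finset.sum_le_sum fun j _ =>
          hyoung l _ _ hl (mul_nonneg hT'.le (hPnonneg p hp j))
      refine le_trans ?_ (add_le_add_right (mul_le_mul_of_nonneg_left h1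
        (EReal.coe_nonneg.2 (inv_pos.2 hT').le)) _)
      rw [← EReal.coe_mul, ← EReal.coe_add, EReal.coe_le_coe_iff]
      have h2 : ∑ j, (T * p j * (a j - ξ) - l * φ (T * p j))
          = T * (∑ j, p j * a j - ξ * ∑ j, p j) - l * ∑ j, φ (T * p j) := by
        rw [Finset.mul_sum, Finset.mul_sum, ← Finset.sum_sub_distrib, Finset.mul_sum,
          ← Finset.sum_sub_distrib]
        exact Finset.sum_congr rfl fun j _ => by ring
      rw [h2, hPsum p hp, mul_sub, inv_mul_cancel_left₀ hT'.ne']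
      have h3 := mul_le_mul_of_nonneg_left (hPdiv p hp) (Set.mem_Ici.1 hl)
      linarith
    clear_value E
    induction E with
    | bot => exact absurd (hweak _ huniform) (EReal.bot_lt_coe _).not_ge
    | top => exact le_top
    | coe e =>
      simp only [EReal.coe_le_coe_iff] at hweak ⊢
      have h0 : 0 ≤ e + y := by
        have h1 : 0 ≤ ∑ j, (T : ℝ)⁻¹ * a j := Finset.sum_nonneg fun j _ =>
          mul_nonneg (inv_pos.2 hT').le (hRnonneg _)
        linarith [hweak _ huniform]
      have := Real.iSup_le (fun p => Real.iSup_le (fun hp : p ∈ P =>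
        (by linarith [hweak p hp] : ∑ j, p j * a j ≤ e + y)) h0) h0
      linarith
  · refine le_iInf₂ fun z hz => le_iInf fun c => ?_
    set a : Fin T → ℝ := fun j => R ((∑ i, ε j i * z i) - c)
    set y : ℝ := γ * ∑ i, yhat i * z i
    change _ ≤ (((⨆ p ∈ P, ∑ j, p j * a j) - y : ℝ) : EReal)
    set V : ℝ := ⨆ p ∈ P, ∑ j, p j * a j
    have ha0 : ∀ j, 0 ≤ a j := fun j => hRnonneg _
    have hbdd : BddAbove (Set.range fun p : Fin T → ℝ => ⨆ _ : p ∈ P, ∑ j, p j * a j) := by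
      refine ⟨∑ j, a j, ?_⟩
      rintro _ ⟨p, rfl⟩
      refine Real.iSup_le (fun hp => Finset.sum_le_sum fun j _ => ?_)
        (Finset.sum_nonneg fun j _ => ha0 j)
      have h1 : p j ≤ 1 := by
        rw [← hPsum p hp]
        exact Finset.single_le_sum (fun i _ => hPnonneg p hp i) (Finset.mem_univ j)
      exact mul_le_of_le_one_left (ha0 j) h1
    have hV : ∀ s : Fin T → ℝ, (∀ j, 0 ≤ s j) → (T : ℝ)⁻¹ * ∑ j, s j = 1 →
        (T : ℝ)⁻¹ * ∑ j, φ (s j) ≤ δ → (T : ℝ)⁻¹ * ∑ j, s j * a j ≤ V := by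
      intro s hs h1 h2
      have hp : (fun j => (T : ℝ)⁻¹ * s j) ∈ P := by
        rw [hP]
        refine ⟨fun j => mul_nonneg (inv_pos.2 hT').le (hs j), ?_, ?_⟩
        · rw [← Finset.mul_sum, h1]
        · refine le_trans (le_of_eq ?_) h2
          rw [Finset.mul_sum]
          exact Finset.sum_congr rfl fun j _ => by
            rw [one_div, mul_div_cancel_left₀ _ (inv_pos.2 hT').ne']
      have h3 := le_ciSup hbdd (fun j => (T : ℝ)⁻¹ * s j)
      simp only [ciSup_pos hp] at h3
      refine le_trans (le_of_eq ?_) h3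
      rw [Finset.mul_sum]
      exact Finset.sum_congr rfl fun j _ => by ring
    refine EReal.le_of_forall_lt_iff_le.1 fun x hx => ?_
    rw [EReal.coe_lt_coe_iff] at hx
    obtain ⟨l, ξ, hl, h⟩ := exists_approx_lagrange_multipliers hT hφconv hφ1 hδ ha0 hV
      (η := (x - (V - y)) / δ) (div_pos (by linarith) hδ)
    rw [mul_div_cancel₀ _ hδ.ne'] at h
    refine (iInf₂_le z hz).trans ((iInf₂_le l hl.le).trans
      ((iInf_le _ ξ).trans ((iInf_le _ c).trans ?_)))
    change ((ξ + δ * l - y : ℝ) : EReal)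
      + (((T : ℝ)⁻¹ : ℝ) : EReal) * ∑ j, persp l (a j - ξ) ≤ x
    obtain ⟨M, hM, hMsum⟩ := exists_separate_bounds (S := Set.Ici (0 : ℝ)) Set.nonempty_Ici
      (fun j s => s * (a j - ξ) - l * φ s) (T * (x + y - ξ - δ * l)) (fun s hs => by
        have := h s hs
        rw [← inv_mul_le_iff₀ hT']
        linarith)
    have h1 : ∑ j, persp l (a j - ξ) ≤ ((∑ j, M j : ℝ) : EReal) := by
      rw [EReal.coe_finset_sum]
      refine Finset.sum_le_sum fun j _ => ?_
      rw [hperspPos l _ hl]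
      exact mul_conjugate_le hφstar hl (hM j)
    refine (add_le_add_right (mul_le_mul_of_nonneg_left h1
      (EReal.coe_nonneg.2 (inv_pos.2 hT').le)) _).trans ?_
    rw [← EReal.coe_mul, ← EReal.coe_add, EReal.coe_le_coe_iff]
    rw [← inv_mul_le_iff₀ hT'] at hMsum
    linarith
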